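/- Let R be an infinite integral domain and A a matrix with entries in R. Then the system Ax = 0 is partition regular over R if and only if A satisfies the columns condition. -/

import Mathlib

open BigOperators

/-- A matrix `A` over `S` is partition regular over the `S`-module `M` for `r` colours if
every colouring of `M` with `r` colours admits a nonzero monochromatic solution of `A m = 0`. -/
def IsPR {S : Type*} [CommRing S] {k l : ℕ} (A : Matrix (Fin k) (Fin l) S)
    (M : Type*) [AddCommGroup M] [Module S M] (r : ℕ) : Prop :=
  ∀ χ : M → Fin r, ∃ m : Fin l → M, m ≠ 0 ∧
    (∀ i, ∑ j, A i j • m j = 0) ∧ ∀ j j', χ (m j) = χ (m j')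

/-- Partition regularity for every (positive) finite number of colours. -/
def IsPRAll {S : Type*} [CommRing S] {k l : ℕ} (A : Matrix (Fin k) (Fin l) S)
    (M : Type*) [AddCommGroup M] [Module S M] : Prop :=
  ∀ r : ℕ, 1 ≤ r → IsPR A M r

/-- The columns condition for a matrix over a domain, with the span taken in the
fraction field. -/
def ColumnsCondition {R : Type*} [CommRing R] [IsDomain R] {k l : ℕ}
    (A : Matrix (Fin k) (Fin l) R) : Prop :=
  ∃ (m : ℕ) (I : Fin (m + 1) → Finset (Fin l)),
    (∀ t, (I t).Nonempty) ∧
    (∀ t t', t ≠ t' → Disjoint (I t) (I t')) ∧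
    (∀ j : Fin l, ∃ t, j ∈ I t) ∧
    (∀ i : Fin k, ∑ j ∈ I 0, A i j = 0) ∧
    ∀ t : Fin (m + 1), 0 < t →
      (fun i : Fin k => algebraMap R (FractionRing R) (∑ j ∈ I t, A i j)) ∈
        Submodule.span (FractionRing R)
          ((fun j (i : Fin k) => algebraMap R (FractionRing R) (A i j)) ''
            {j | ∃ t', t' < t ∧ j ∈ I t'})

universe uT uM

lemma exists_levels {T : Type uT} {M : Type uM} [CommRing T] [IsLocalRing T] [AddCommGroup M] [Module T M] :
    ∃ (Γ : Type uM) (_ : LinearOrder Γ) (w : M → Γ) (c : M → IsLocalRing.ResidueField T),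
      (∀ x, c x = 0 ↔ x = 0) ∧
      ∀ (l : ℕ) (J : Finset (Fin l)) (s : Fin l → T) (m : Fin l → M) (γ : Γ)
        (κ : IsLocalRing.ResidueField T), κ ≠ 0 →
        (∀ j ∈ J, c (m j) = κ ∧ γ ≤ w (m j)) → ∑ j ∈ J, s j • m j = 0 →
        ∑ j ∈ J with w (m j) = γ, IsLocalRing.residue T (s j) = 0 := by
  classical
  obtain ⟨F⟩ : Nonempty (Flag (Submodule T M)) :=
    ⟨Flag.ofIsMaxChain _ maxChain_spec⟩
  let lo : M → Submodule T M := fun x => sSup {N | N ∈ F ∧ x ∉ N}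
  let hi : M → Submodule T M := fun x => sInf {N | N ∈ F ∧ x ∈ N}
  have tot : ∀ N ∈ F, ∀ N' ∈ F, N ≤ N' ∨ N' ≤ N := fun N hN N' hN' => F.le_or_le hN hN'
  have mem_hi : ∀ x, x ∈ hi x := by
    intro x
    simp only [hi, Submodule.mem_sInf]
    exact fun N hN => hN.2
  have le_lo : ∀ x, ∀ N ∈ F, x ∉ N → N ≤ lo x := fun x N hN hx => le_sSup ⟨hN, hx⟩
  have hi_le : ∀ x, ∀ N ∈ F, x ∈ N → hi x ≤ N := fun x N hN hx => sInf_le ⟨hN, hx⟩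
  have lo_le_hi : ∀ x, lo x ≤ hi x := by
    intro x
    refine sSup_le fun N hN => le_sInf fun N' hN' => ?_
    exact (tot N hN.1 N' hN'.1).resolve_right fun h => hN.2 (h hN'.2)
  have mid : ∀ x N, lo x ≤ N → N ≤ hi x → N ∈ F := by
    intro x N h1 h2
    rw [Flag.mem_iff_forall_le_or_ge]
    intro b hb
    by_cases hxb : x ∈ b
    · exact Or.inl (h2.trans (hi_le x b hb hxb))
    · exact Or.inr ((le_lo x b hb hxb).trans h1)
  have hi_mem : ∀ x, hi x ∈ F := fun x => mid x _ (lo_le_hi x) le_rfl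
  have bot_mem : ⊥ ∈ F := by
    rw [Flag.mem_iff_forall_le_or_ge]
    exact fun b _ => Or.inl bot_le
  have not_lo : ∀ x, x ≠ 0 → x ∉ lo x := by
    intro x hx h
    simp only [lo] at h
    have hne : {N | N ∈ F ∧ x ∉ N}.Nonempty := ⟨⊥, bot_mem, by simpa using hx⟩
    rw [Submodule.mem_sSup_of_directed hne] at h
    · obtain ⟨N, hN, hxN⟩ := h
      exact hN.2 hxN
    · intro N hN N' hN'
      rcases tot N hN.1 N' hN'.1 with h | h
      · exact ⟨N', hN', h, le_rfl⟩
      · exact ⟨N, hN, le_rfl, h⟩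
  have hspan : ∀ x y, y ∈ hi x → ∃ s : T, y - s • x ∈ lo x := by
    intro x y hy
    have h1 : lo x ⊔ Submodule.span T {x} ∈ F := by
      refine mid x _ le_sup_left (sup_le (lo_le_hi x) ?_)
      rw [Submodule.span_singleton_le_iff_mem]
      exact mem_hi x
    have h2 := hi_le x _ h1 (Submodule.mem_sup_right (Submodule.mem_span_singleton_self x)) hy
    obtain ⟨a, ha, b, hb, hab⟩ := Submodule.mem_sup.1 h2
    obtain ⟨s, rfl⟩ := Submodule.mem_span_singleton.1 hb
    refine ⟨s, ?_⟩
    rw [← hab]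
    simpa using ha
  have lo_congr : ∀ x y, hi x = hi y → lo x = lo y := by
    intro x y h
    have : ∀ N, (N ∈ F ∧ x ∉ N) ↔ (N ∈ F ∧ y ∉ N) := by
      intro N
      refine and_congr_right fun hN => not_congr ⟨fun hx => ?_, fun hy => ?_⟩
      · exact (h ▸ hi_le x N hN hx) (mem_hi y)
      · exact (h ▸ hi_le y N hN hy) (mem_hi x)
    simp only [lo, this]
  have lt_lo : ∀ x y, hi x < hi y → x ∈ lo y := by
    intro x y h
    refine le_lo y _ (hi_mem x) (fun hy => ?_) (mem_hi x)
    exact not_lt_of_ge (hi_le y _ (hi_mem x) hy) h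
  have nonunit : ∀ u, u ≠ 0 → ∀ s : T, IsLocalRing.residue T s = 0 → s • u ∈ lo u := by
    intro u hu s hs
    rw [IsLocalRing.residue_eq_zero_iff, IsLocalRing.mem_maximalIdeal, mem_nonunits_iff] at hs
    have h1 : lo u ⊔ Submodule.span T {s • u} ∈ F := by
      refine mid u _ le_sup_left (sup_le (lo_le_hi u) ?_)
      rw [Submodule.span_singleton_le_iff_mem]
      exact Submodule.smul_mem _ _ (mem_hi u)
    refine le_lo u _ h1 (fun h2 => ?_)
      (Submodule.mem_sup_right (Submodule.mem_span_singleton_self _))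
    obtain ⟨a, ha, b, hb, hab⟩ := Submodule.mem_sup.1 h2
    obtain ⟨t, rfl⟩ := Submodule.mem_span_singleton.1 hb
    have h3 : (1 - t * s) • u = a := by
      rw [sub_smul, one_smul, mul_smul, sub_eq_iff_eq_add, hab]
    have h4 : IsUnit (1 - t * s) := by
      by_contra hn
      have h5 := IsLocalRing.isUnit_or_isUnit_one_sub_self (t * s)
      rcases h5 with h5 | h5
      · exact hs (isUnit_of_mul_isUnit_right h5)
      · exact hn h5
    refine not_lo u hu ?_
    rw [← (Submodule.smul_mem_iff_of_isUnit _ h4), h3]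
    exact ha
  let u : M → M := fun x => Classical.epsilon (fun y => y ≠ 0 ∧ hi y = hi x)
  have hu : ∀ x, x ≠ 0 → u x ≠ 0 ∧ hi (u x) = hi x := fun x hx =>
    Classical.epsilon_spec (p := fun y => y ≠ 0 ∧ hi y = hi x) ⟨x, hx, rfl⟩
  have u_congr : ∀ x y, hi x = hi y → u x = u y := by
    intro x y h
    simp only [u, h]
  have hs : ∀ x, ∃ s : T, x ≠ 0 → x - s • u x ∈ lo x := by
    intro x
    by_cases hx : x = 0
    · exact ⟨0, fun h => absurd hx h⟩
    · obtain ⟨s, hs⟩ := hspan (u x) x ((hu x hx).2 ▸ mem_hi x)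
      exact ⟨s, fun _ => lo_congr _ _ (hu x hx).2 ▸ hs⟩
  choose σ hσ using hs
  refine ⟨(F : Type _)ᵒᵈ, inferInstance, fun x => OrderDual.toDual ⟨hi x, hi_mem x⟩,
    fun x => if x = 0 then 0 else IsLocalRing.residue T (σ x), ?_, ?_⟩
  · intro x
    by_cases hx : x = 0
    · simp [hx]
    · simp only [hx, if_false, iff_false]
      intro h
      have h1 := nonunit (u x) (hu x hx).1 _ h
      rw [lo_congr _ _ (hu x hx).2] at h1
      refine not_lo x hx ?_
      have := Submodule.add_mem _ (hσ x hx) h1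
      simpa using this
  · intro l J s m γ κ hκ hJ hsum
    rcases (J.filter (fun j => OrderDual.toDual (⟨hi (m j), hi_mem (m j)⟩ : F) = γ)).eq_empty_or_nonempty
      with hemp | ⟨j0, hj0⟩
    · rw [hemp, Finset.sum_empty]
    rw [Finset.mem_filter] at hj0
    obtain ⟨hj0J, rfl⟩ := hj0
    have hm0 : ∀ j ∈ J, m j ≠ 0 := by
      intro j hj h0
      have := (hJ j hj).1
      beta_reduce at this
      rw [if_pos h0] at this
      exact hκ this.symm
    have hres : ∀ j ∈ J, IsLocalRing.residue T (σ (m j)) = κ := by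
      intro j hj
      have := (hJ j hj).1
      beta_reduce at this
      rwa [if_neg (hm0 j hj)] at this
    have hle : ∀ j ∈ J, hi (m j) ≤ hi (m j0) := fun j hj => (hJ j hj).2
    have heq : ∀ j, (OrderDual.toDual (⟨hi (m j), hi_mem (m j)⟩ : F)
        = OrderDual.toDual (⟨hi (m j0), hi_mem (m j0)⟩ : F)) ↔ hi (m j) = hi (m j0) := by
      intro j
      rw [OrderDual.toDual_inj, Subtype.mk.injEq]
    simp only [heq]
    have hz0 := hm0 j0 hj0J
    have hdiff : ∑ j ∈ J, (s j • m j - (if hi (m j) = hi (m j0) then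
        (s j * σ (m j)) • u (m j0) else 0)) ∈ lo (m j0) := by
      refine Submodule.sum_mem _ fun j hj => ?_
      split_ifs with h
      · rw [mul_smul, ← smul_sub]
        refine Submodule.smul_mem _ _ ?_
        rw [← u_congr _ _ h, ← lo_congr _ _ h]
        exact hσ _ (hm0 j hj)
      · rw [sub_zero]
        exact Submodule.smul_mem _ _ (lt_lo _ _ (lt_of_le_of_ne (hle j hj) h))
    rw [Finset.sum_sub_distrib, hsum, zero_sub, Submodule.neg_mem_iff, ← Finset.sum_filter,
      ← Finset.sum_smul, ← lo_congr _ _ (hu _ hz0).2] at hdiff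
    have hr0 : IsLocalRing.residue T
        (∑ j ∈ J with hi (m j) = hi (m j0), s j * σ (m j)) = 0 := by
      by_contra hne
      rw [← ne_eq, IsLocalRing.residue_ne_zero_iff_isUnit] at hne
      rw [Submodule.smul_mem_iff_of_isUnit _ hne] at hdiff
      exact not_lo _ (hu _ hz0).1 hdiff
    rw [map_sum] at hr0
    have : ∑ j ∈ J with hi (m j) = hi (m j0), IsLocalRing.residue T (s j * σ (m j))
        = (∑ j ∈ J with hi (m j) = hi (m j0), IsLocalRing.residue T (s j)) * κ := by
      rw [Finset.sum_mul]
      refine Finset.sum_congr rfl fun j hj => ?_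
      rw [map_mul, hres j (Finset.mem_filter.1 hj).1]
    rw [this] at hr0
    exact (mul_eq_zero.1 hr0).resolve_right hκ

lemma finite_of_moduleFinite_int (k : Type*) [Field k] [Module.Finite ℤ k] : Finite k := by
  have hinj : ¬ Function.Injective (algebraMap ℤ k) := by
    intro h
    have : Algebra.IsIntegral ℤ k := inferInstance
    exact Int.not_isField (isField_of_isIntegral_of_isField h (Field.toIsField k))
  rw [injective_iff_map_eq_zero] at hinj
  push Not at hinj
  obtain ⟨a, ha, ha0⟩ := hinj
  refine Module.finite_of_fg_torsion k ?_
  intro x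
  refine ⟨⟨a, mem_nonZeroDivisors_of_ne_zero ha0⟩, ?_⟩
  change a • x = 0
  rw [Algebra.smul_def, ha, zero_mul]

lemma int_isJacobsonRing : IsJacobsonRing ℤ := by
  rw [isJacobsonRing_iff_prime_eq]
  intro P hP
  by_cases h : P = ⊥
  · subst h
    refine le_antisymm (fun x hx => ?_) Ideal.le_jacobson
    rw [Ideal.mem_jacobson_bot] at hx
    have := hx x
    rw [Int.isUnit_iff] at this
    rw [Ideal.mem_bot]
    rcases this with h | h <;> nlinarith
  · have := hP.isMaximal h
    exact Ideal.jacobson_eq_self_of_isMaximal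

lemma exists_local {K : Type*} [Field K] (S : Set K) (hS : S.Finite) :
    ∃ (T : Subring K) (_ : IsLocalRing T), S ⊆ T ∧ Finite (IsLocalRing.ResidueField T) := by
  let A : Subring K := (Algebra.adjoin ℤ S).toSubring
  have hft : Algebra.FiniteType ℤ A := by
    have : Algebra.FiniteType ℤ (Algebra.adjoin ℤ S) :=
      (Subalgebra.fg_iff_finiteType _).1 (Subalgebra.fg_def.2 ⟨S, hS, rfl⟩)
    exact this
  obtain ⟨P, hP⟩ := Ideal.exists_maximal A
  let _ : Field (A ⧸ P) := Ideal.Quotient.field P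
  have h1 : Algebra.FiniteType ℤ (A ⧸ P) := inferInstance
  have := int_isJacobsonRing
  have h2 : Module.Finite ℤ (A ⧸ P) := finite_of_finite_type_of_isJacobsonRing ℤ (A ⧸ P)
  have h3 : Finite (A ⧸ P) := finite_of_moduleFinite_int _
  refine ⟨(LocalSubring.ofPrime A P).toSubring, inferInstance, ?_, ?_⟩
  · exact fun x hx => LocalSubring.le_ofPrime A P (Algebra.subset_adjoin hx)
  · exact Finite.of_equiv _
      (IsLocalization.AtPrime.equivQuotMaximalIdeal P (LocalSubring.ofPrime A P).toSubring).toEquiv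


lemma columnsCondition_of_pr {R : Type*} [CommRing R] [IsDomain R]
    {k l : ℕ} (A : Matrix (Fin k) (Fin l) R) (hA : IsPRAll A R) : ColumnsCondition A := by
  classical
  let K := FractionRing R
  let a : Fin l → Fin k → K := fun j i => algebraMap R K (A i j)
  have hφ : ∀ p : Finset (Fin l) × Finset (Fin l), ∃ φ : (Fin k → K) →ₗ[K] K,
      ∑ j ∈ p.1, a j ∉ Submodule.span K (a '' p.2) →
        (∀ j ∈ p.2, φ (a j) = 0) ∧ φ (∑ j ∈ p.1, a j) = 1 := by
    intro p
    by_cases h : ∑ j ∈ p.1, a j ∈ Submodule.span K (a '' p.2)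
    · exact ⟨0, fun h' => absurd h h'⟩
    · obtain ⟨f, hf, hle⟩ := Submodule.exists_le_ker_of_notMem h
      refine ⟨(f (∑ j ∈ p.1, a j))⁻¹ • f, fun _ => ⟨fun j hj => ?_, ?_⟩⟩
      · have : f (a j) = 0 := hle (Submodule.subset_span ⟨j, hj, rfl⟩)
        simp [this]
      · rw [LinearMap.smul_apply, smul_eq_mul]
        exact inv_mul_cancel₀ hf
  choose φ hφ using hφ
  obtain ⟨T, hT, hST, hfin⟩ := exists_local
    (Set.range (fun q : (Finset (Fin l) × Finset (Fin l)) × Fin l => φ q.1 (a q.2)))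
    (Set.finite_range _)
  obtain ⟨Γ, _, w, c, hc0, hlev⟩ := exists_levels (T := T) (M := K)
  let e := Finite.equivFin (IsLocalRing.ResidueField T)
  obtain ⟨m, hm, hsol, hmono⟩ := hA _ Nat.card_pos (fun x => e (c (algebraMap R K x)))
  have inj := IsFractionRing.injective R K
  obtain ⟨j0, hj0⟩ := Function.ne_iff.1 hm
  let y : Fin l → K := fun j => algebraMap R K (m j)
  let κ := c (y j0)
  have hκ : κ ≠ 0 := by
    intro h
    rw [hc0] at h
    exact hj0 ((map_eq_zero_iff _ inj).1 h)
  have hcol : ∀ j, c (y j) = κ := fun j => e.injective (hmono j j0)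
  have hy : ∑ j, y j • a j = 0 := by
    ext i
    have := congrArg (algebraMap R K) (hsol i)
    rw [map_sum, map_zero] at this
    rw [Finset.sum_apply, Pi.zero_apply, ← this]
    refine Finset.sum_congr rfl fun j _ => ?_
    simp [y, a, mul_comm]
  let W : Finset Γ := Finset.univ.image (fun j => w (y j))
  have hWne : W.Nonempty := ⟨w (y j0), Finset.mem_image_of_mem _ (Finset.mem_univ _)⟩
  obtain ⟨n, hn⟩ : ∃ n, W.card = n + 1 :=
    ⟨W.card - 1, (Nat.succ_pred_eq_of_pos (Finset.card_pos.2 hWne)).symm⟩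
  let g := W.orderEmbOfFin hn
  have hg : ∀ j, ∃ t, g t = w (y j) := by
    intro j
    have : w (y j) ∈ Set.range g := by
      rw [Finset.range_orderEmbOfFin]
      exact Finset.mem_coe.2 (Finset.mem_image_of_mem _ (Finset.mem_univ _))
    exact this
  let I : Fin (n + 1) → Finset (Fin l) := fun t => Finset.univ.filter (fun j => w (y j) = g t)
  have key : ∀ t, ∑ j ∈ I t, a j ∈ Submodule.span K (a '' {j | w (y j) < g t}) := by
    intro t
    by_contra hcon
    let J : Finset (Fin l) := Finset.univ.filter (fun j => w (y j) < g t)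
    have hJ : (J : Set (Fin l)) = {j | w (y j) < g t} := by ext j; simp [J]
    rw [← hJ] at hcon
    obtain ⟨h0, h1⟩ := hφ (I t, J) hcon
    let s : Fin l → T := fun j => ⟨φ (I t, J) (a j), hST ⟨((I t, J), j), rfl⟩⟩
    have hs := hlev l (Finset.univ.filter (fun j => g t ≤ w (y j))) s y (g t) κ hκ
      (fun j hj => ⟨hcol j, (Finset.mem_filter.1 hj).2⟩) (by
        rw [Finset.sum_filter]
        have h2 := congrArg (φ (I t, J)) hy
        rw [map_sum, map_zero] at h2
        refine Eq.trans ?_ h2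
        refine Finset.sum_congr rfl fun j _ => ?_
        rw [map_smul]
        split_ifs with h
        · rw [smul_eq_mul, mul_comm]
          rfl
        · have : φ (I t, J) (a j) = 0 := h0 j (by
            simp only [J, Finset.mem_filter, Finset.mem_univ, true_and]
            exact not_le.1 h)
          rw [this, smul_zero])
    have hfil : (Finset.univ.filter (fun j => g t ≤ w (y j))).filter (fun j => w (y j) = g t)
        = I t := by
      ext j
      simp only [I, Finset.mem_filter, Finset.mem_univ, true_and]
      exact ⟨fun h => h.2, fun h => ⟨h.ge, h⟩⟩
    rw [hfil, ← map_sum] at hs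
    have hs1 : ∑ j ∈ I t, s j = 1 := by
      apply Subtype.ext
      have : ((∑ j ∈ I t, s j : T) : K) = ∑ j ∈ I t, (s j : K) := by
        exact map_sum T.subtype _ _
      rw [this]
      rw [map_sum] at h1
      exact h1
    rw [hs1, map_one] at hs
    exact one_ne_zero hs
  refine ⟨n, I, ?_, ?_, ?_, ?_, ?_⟩
  · intro t
    have : g t ∈ W := Finset.orderEmbOfFin_mem W hn t
    obtain ⟨j, -, hj⟩ := Finset.mem_image.1 this
    exact ⟨j, by simp [I, hj]⟩
  · intro t t' htt
    rw [Finset.disjoint_left]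
    intro j h1 h2
    simp only [I, Finset.mem_filter, Finset.mem_univ, true_and] at h1 h2
    exact htt (g.injective (h1.symm.trans h2))
  · intro j
    obtain ⟨t, ht⟩ := hg j
    exact ⟨t, by simp [I, ht]⟩
  · intro i
    have h0 := key 0
    have : {j | w (y j) < g 0} = ∅ := by
      ext j
      obtain ⟨t, ht⟩ := hg j
      simp [← ht]
    rw [this, Set.image_empty, Submodule.span_empty, Submodule.mem_bot] at h0
    apply inj
    have := congrFun h0 i
    rw [Finset.sum_apply] at this
    rw [map_sum, map_zero]
    exact this
  · intro t _
    have ht := key t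
    have e1 : {j | w (y j) < g t} = {j | ∃ t', t' < t ∧ j ∈ I t'} := by
      ext j
      simp only [Set.mem_ofPred_eq, I, Finset.mem_filter, Finset.mem_univ, true_and]
      constructor
      · intro h
        obtain ⟨t', ht'⟩ := hg j
        rw [← ht', OrderEmbedding.lt_iff_lt] at h
        exact ⟨t', h, ht'.symm⟩
      · rintro ⟨t', h, h'⟩
        rw [h', OrderEmbedding.lt_iff_lt]
        exact h
    rw [e1] at ht
    convert ht using 1
    ext i
    rw [Finset.sum_apply, map_sum]

lemma exists_weights (R : Type*) [AddCommGroup R] [Infinite R] (ι : Type*) [Fintype ι] :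
    ∃ v : ι → R, ∀ s : Finset ι, s.Nonempty → ∑ i ∈ s, v i ≠ 0 := by
  classical
  have key : ∀ T : Finset ι, ∃ v : ι → R, ∀ s ⊆ T, s.Nonempty → ∑ i ∈ s, v i ≠ 0 := by
    intro T
    induction T using Finset.induction_on with
    | empty =>
      refine ⟨0, fun s hs hne => ?_⟩
      rw [Finset.subset_empty] at hs
      simp [hs] at hne
    | insert a T ha ih =>
      obtain ⟨v, hv⟩ := ih
      obtain ⟨x, hx⟩ := Infinite.exists_notMem_finset
        (T.powerset.image (fun s => -∑ i ∈ s, v i))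
      have hupd : ∀ s ⊆ T, ∑ i ∈ s, Function.update v a x i = ∑ i ∈ s, v i := by
        intro s hs
        refine Finset.sum_congr rfl fun i hi => ?_
        rw [Function.update_of_ne]
        rintro rfl
        exact ha (hs hi)
      refine ⟨Function.update v a x, fun s hs hne h0 => ?_⟩
      by_cases has : a ∈ s
      · have hsT : s.erase a ⊆ T := by
          intro i hi
          rw [Finset.mem_erase] at hi
          exact (Finset.mem_insert.1 (hs hi.2)).resolve_left hi.1
        rw [← Finset.add_sum_erase _ _ has, hupd _ hsT, Function.update_self] at h0
        apply hx
        rw [Finset.mem_image]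
        exact ⟨s.erase a, Finset.mem_powerset.2 hsT, (eq_neg_of_add_eq_zero_left h0).symm⟩
      · have hsT : s ⊆ T := by
          intro i hi
          refine (Finset.mem_insert.1 (hs hi)).resolve_left ?_
          rintro rfl
          exact has hi
        rw [hupd _ hsT] at h0
        exact hv s hsT hne h0
  obtain ⟨v, hv⟩ := key Finset.univ
  exact ⟨v, fun s hs => hv s (Finset.subset_univ _) hs⟩

lemma exists_homothety {R : Type*} [CommRing R] [IsDomain R] [Infinite R]
    (S : Finset R) (c : R) (hc : c ≠ 0) (κ : Type*) [Finite κ] :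
    ∃ F : Set R, F.Finite ∧ ∀ χ : R → κ, ∃ b ∈ F, ∃ d ∈ F, b ≠ 0 ∧ d ≠ 0 ∧
      ∃ col, ∀ s ∈ S, χ (c * b + d * s) = col := by
  classical
  obtain ⟨ι, _, hι⟩ := Combinatorics.Line.exists_mono_in_high_dimension S κ
  obtain ⟨v, hv⟩ := exists_weights R ι
  let g : (ι → Option S) → R := fun f => ∑ i, v i * ((f i).map Subtype.val).getD 0
  obtain ⟨e, he⟩ := (Set.finite_range (fun f => - g f)).exists_notMem
  let d : (ι → Option S) → R := fun f => c * ∑ i with f i = none, v i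
  refine ⟨Set.range (fun f => e + g f) ∪ Set.range d,
    (Set.finite_range _).union (Set.finite_range _), fun χ => ?_⟩
  obtain ⟨l, col, hl⟩ := hι (fun f => χ (c * (e + ∑ i, v i * (f i : R))))
  refine ⟨e + g l.idxFun, Or.inl ⟨_, rfl⟩, d l.idxFun, Or.inr ⟨_, rfl⟩, ?_, ?_, col, ?_⟩
  · intro h
    exact he ⟨l.idxFun, (eq_neg_of_add_eq_zero_left h).symm⟩
  · refine mul_ne_zero hc (hv _ ?_)
    obtain ⟨i, hi⟩ := l.proper
    exact ⟨i, by simp [hi]⟩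
  · intro s hs
    rw [← hl ⟨s, hs⟩]
    congr 1
    simp only [g, d]
    rw [mul_assoc, ← mul_add, add_assoc, Finset.sum_filter, Finset.sum_mul,
      ← Finset.sum_add_distrib]
    congr 2
    refine Finset.sum_congr rfl fun i _ => ?_
    rw [Combinatorics.Line.apply_def]
    rcases h : l.idxFun i with _ | y <;> simp [h]

lemma exists_deuber {R : Type*} [CommRing R] [IsDomain R] [Infinite R]
    (P : Finset R) (c : R) (hc : c ≠ 0) (κ : Type*) [Finite κ] (M : ℕ) :
    ∃ F : Set R, F.Finite ∧ ∀ χ : R → κ, ∃ x : Fin M → R, (∀ t, x t ∈ F ∧ x t ≠ 0) ∧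
      ∃ col : Fin M → κ, ∀ t, ∀ μ : Fin M → R, (∀ t', μ t' ∈ P) →
        χ (c * x t + ∑ t', if t < t' then μ t' * x t' else 0) = col t := by
  classical
  induction M with
  | zero => exact ⟨∅, Set.finite_empty, fun χ => ⟨fun t => t.elim0, fun t => t.elim0,
      fun t => t.elim0, fun t => t.elim0⟩⟩
  | succ M ih =>
    obtain ⟨F, hF, h⟩ := ih
    -- all linear combinations
    have hfin : (Set.range (fun p : (Fin M → F) × (Fin M → P) =>
        ∑ t, (p.2 t : R) * (p.1 t : R))).Finite := by
      have := hF.to_subtype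
      exact Set.finite_range _
    obtain ⟨F', hF', h'⟩ := exists_homothety hfin.toFinset c hc κ
    refine ⟨F' ∪ Set.image2 (· * ·) F' F, hF'.union (hF'.image2 _ hF), fun χ => ?_⟩
    obtain ⟨b, hb, d, hd, hb0, hd0, col0, hcol0⟩ := h' χ
    obtain ⟨x, hx, col, hcol⟩ := h (fun y => χ (d * y))
    refine ⟨Fin.cons b (fun t => d * x t), ?_, Fin.cons col0 col, ?_⟩
    · intro t
      refine Fin.cases ?_ (fun t => ?_) t
      · exact ⟨Or.inl hb, hb0⟩
      · exact ⟨Or.inr ⟨d, hd, x t, (hx t).1, rfl⟩, mul_ne_zero hd0 (hx t).2⟩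
    · intro t μ hμ
      revert t
      refine Fin.cases ?_ (fun t => ?_)
      · have := hcol0 (∑ t, μ t.succ * x t) (by
          rw [Set.Finite.mem_toFinset]
          exact ⟨(fun t => ⟨x t, (hx t).1⟩, fun t => ⟨μ t.succ, hμ _⟩), rfl⟩)
        rw [Fin.sum_univ_succ]
        simp only [Fin.cons_zero, Fin.cons_succ, lt_self_iff_false, if_false, zero_add,
          Fin.succ_pos, if_true]
        rw [← this, Finset.mul_sum]
        congr 2
        exact Finset.sum_congr rfl fun i _ => by ring
      · have := hcol t (fun t' => μ t'.succ) (fun t' => hμ _)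
        rw [Fin.sum_univ_succ]
        simp only [Fin.cons_zero, Fin.cons_succ, Fin.not_lt_zero, if_false, zero_add,
          Fin.succ_lt_succ_iff]
        rw [← this, mul_add, Finset.mul_sum]
        congr 2
        · ring
        · exact Finset.sum_congr rfl fun i _ => by split_ifs <;> ring

lemma exists_deuber_mono {R : Type*} [CommRing R] [IsDomain R] [Infinite R]
    (P : Finset R) (hP : (0 : R) ∈ P) (c : R) (hc : c ≠ 0) (r : ℕ) (m : ℕ) (χ : R → Fin r) :
    ∃ x : Fin m → R, (∀ t, x t ≠ 0) ∧
      ∃ col, ∀ t, ∀ μ : Fin m → R, (∀ t', μ t' ∈ P) →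
        χ (c * x t + ∑ t', if t < t' then μ t' * x t' else 0) = col := by
  classical
  obtain ⟨F, -, h⟩ := exists_deuber P c hc (Fin r) (r * m + 1)
  obtain ⟨x, hx, col, hcol⟩ := h χ
  obtain ⟨k, hk⟩ := Fintype.exists_lt_card_fiber_of_mul_lt_card (n := m) col (by simp)
  obtain ⟨T, hT, hTc⟩ := Finset.exists_subset_card_eq hk.le
  let e := T.orderEmbOfFin hTc
  refine ⟨fun t => x (e t), fun t => (hx _).2, k, fun t μ hμ => ?_⟩
  have hek : col (e t) = k := by
    have := hT (Finset.orderEmbOfFin_mem T hTc t)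
    simpa using this
  rw [← hek, ← hcol (e t) (Function.extend e μ 0)]
  · congr 2
    refine Fintype.sum_of_injective e e.injective _ _ ?_ ?_
    · intro i hi
      rw [Function.extend_apply' _ _ _ (by simpa using hi)]
      simp
    · intro i
      rw [e.injective.extend_apply]
      simp
  · intro t'
    by_cases h : ∃ a, e a = t'
    · obtain ⟨a, rfl⟩ := h
      rw [e.injective.extend_apply]
      exact hμ a
    · rw [Function.extend_apply' _ _ _ h]
      exact hP

lemma pr_of_columnsCondition {R : Type*} [CommRing R] [IsDomain R] [Infinite R]
    {k l : ℕ} (A : Matrix (Fin k) (Fin l) R) (hA : ColumnsCondition A) : IsPRAll A R := by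
  classical
  intro r _ χ
  obtain ⟨m, I, hne, hdisj, hcov, h0, hspan⟩ := hA
  choose τ hτ using hcov
  have hI : ∀ j t, j ∈ I t ↔ τ j = t := by
    intro j t
    constructor
    · intro h
      by_contra hne'
      exact Finset.disjoint_left.1 (hdisj _ _ hne') (hτ j) h
    · rintro rfl
      exact hτ j
  have hβ : ∀ t, ∃ β : Fin l → FractionRing R, (∀ j, ¬ τ j < t → β j = 0) ∧
      ∀ i, algebraMap R (FractionRing R) (∑ j ∈ I t, A i j)
        = ∑ j, β j * algebraMap R (FractionRing R) (A i j) := by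
    intro t
    rcases Fin.eq_zero_or_eq_succ t with rfl | ⟨s, hs⟩
    · refine ⟨0, fun _ _ => rfl, fun i => ?_⟩
      rw [h0]
      simp
    · have := hspan t (by rw [hs]; exact Fin.succ_pos s)
      rw [Finsupp.mem_span_image_iff_linearCombination] at this
      obtain ⟨f, hf, hfe⟩ := this
      refine ⟨f, fun j hj => ?_, fun i => ?_⟩
      · by_contra hfj
        have := (Finsupp.mem_supported _ _).1 hf (Finsupp.mem_support_iff.2 hfj)
        obtain ⟨t', ht', hjt⟩ := this
        rw [hI] at hjt
        exact hj (hjt ▸ ht')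
      · have := congrFun hfe i
        rw [← this, Finsupp.linearCombination_apply, Finsupp.sum_fintype _ _ (by simp)]
        simp [Finset.sum_apply]
  choose β hβ0 hβs using hβ
  obtain ⟨⟨c, hc⟩, hcB⟩ := IsLocalization.exist_integer_multiples_of_finite (nonZeroDivisors R)
    (fun p : Fin (m + 1) × Fin l => β p.1 p.2)
  choose B hB using hcB
  replace hB : ∀ t j, algebraMap R (FractionRing R) (B (t, j))
      = algebraMap R (FractionRing R) c * β t j := by
    intro t j
    rw [hB]
    simp [Algebra.smul_def]
  have inj := IsFractionRing.injective R (FractionRing R)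
  have hB0 : ∀ t j, ¬ τ j < t → B (t, j) = 0 := by
    intro t j h
    apply inj
    rw [hB, hβ0 t j h]
    simp
  have hBs : ∀ t i, c * ∑ j ∈ I t, A i j = ∑ j, B (t, j) * A i j := by
    intro t i
    apply inj
    rw [map_mul, hβs, map_sum, Finset.mul_sum]
    refine Finset.sum_congr rfl fun j _ => ?_
    rw [map_mul, hB, mul_assoc]
  have hc0 : c ≠ 0 := nonZeroDivisors.ne_zero hc
  obtain ⟨x, hx0, col, hcol⟩ := exists_deuber_mono
    (insert 0 (Finset.univ.image (fun p => - B p))) (Finset.mem_insert_self _ _) c hc0 r (m + 1) χ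
  refine ⟨fun j => c * x (τ j) + ∑ t', if τ j < t' then - B (t', j) * x t' else 0, ?_, ?_, ?_⟩
  · obtain ⟨j, hj⟩ := hne (Fin.last m)
    rw [hI] at hj
    intro h
    have := congrFun h j
    simp only [hj, Pi.zero_apply] at this
    rw [Finset.sum_eq_zero] at this
    · rw [add_zero] at this
      exact mul_ne_zero hc0 (hx0 _) this
    · intro t _
      rw [if_neg (not_lt.2 (Fin.le_last t))]
  · intro i
    have e1 : ∀ j, A i j • (c * x (τ j) + ∑ t', if τ j < t' then - B (t', j) * x t' else 0)
        = ∑ t, x t * ((if τ j = t then c * A i j else 0) - B (t, j) * A i j) := by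
      intro j
      simp only [mul_sub, Finset.sum_sub_distrib, mul_ite, mul_zero, Finset.sum_ite_eq,
        Finset.mem_univ, if_true, smul_eq_mul, mul_add, Finset.mul_sum]
      rw [sub_eq_add_neg, ← Finset.sum_neg_distrib]
      congr 1
      · ring
      · refine Finset.sum_congr rfl fun t _ => ?_
        split_ifs with h
        · ring
        · rw [hB0 t j h]; ring
    rw [Finset.sum_congr rfl fun j _ => e1 j, Finset.sum_comm]
    refine Finset.sum_eq_zero fun t _ => ?_
    rw [← Finset.mul_sum, Finset.sum_sub_distrib, ← hBs, ← Finset.sum_filter, ← Finset.mul_sum]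
    have : I t = Finset.univ.filter (fun j => τ j = t) := by
      ext j; simp [hI]
    rw [this]
    simp
  · intro j j'
    have H : ∀ j, χ (c * x (τ j) + ∑ t', if τ j < t' then - B (t', j) * x t' else 0) = col := by
      intro j
      refine hcol (τ j) (fun t' => - B (t', j)) (fun t' => ?_)
      exact Finset.mem_insert_of_mem (Finset.mem_image_of_mem _ (Finset.mem_univ (t', j)))
    rw [H, H]

/-- Rado's theorem for infinite domains. -/
theorem pr_iff_columnsCondition {R : Type*} [CommRing R] [IsDomain R] [Infinite R]
    {k l : ℕ} (A : Matrix (Fin k) (Fin l) R) :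
    IsPRAll A R ↔ ColumnsCondition A := by
  exact ⟨columnsCondition_of_pr A, pr_of_columnsCondition A⟩
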